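/- If A and B are real symmetric positive definite 2N×2N matrices with A ≥ B (i.e., A − B positive semidefinite), then str(A) ≥ str(B), where str denotes the sum of the symplectic eigenvalues. -/

import Mathlib

/-- The standard symplectic form Σ = ⊕₁ᴺ [[0,1],[−1,0]] on ℝ^(2N). -/
def symplecticFormMat (N : ℕ) : Matrix (Fin (2*N)) (Fin (2*N)) ℝ :=
  Matrix.of fun i j =>
    if i.val + 1 = j.val ∧ i.val % 2 = 0 then 1
    else if j.val + 1 = i.val ∧ j.val % 2 = 0 then -1 else 0

/-- The symplectic trace: str(A) is the sum of the symplectic eigenvalues of A,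
i.e. half the sum of the moduli of the imaginary parts of the eigenvalues of ΣA
(counted with algebraic multiplicity). -/
noncomputable def symplTrace {N : ℕ} (A : Matrix (Fin (2*N)) (Fin (2*N)) ℝ) : ℝ :=
  (1/2) * ((((symplecticFormMat N * A).map (fun x : ℝ => (x : ℂ))).charpoly.roots.map
    (fun z => |z.im|)).sum)

open scoped Matrix ComplexOrder MatrixOrder

theorem conjTranspose_map_ofReal {m n : Type*} (M : Matrix m n ℝ) :
    (M.map (algebraMap ℝ ℂ))ᴴ = (Mᵀ).map (algebraMap ℝ ℂ) := by
  ext i j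
  simp

/-- A skew-Hermitian matrix is unitarily diagonalizable with purely imaginary eigenvalues. -/
theorem exists_unitary_diagonal_of_skewHermitian {n : Type*} [Fintype n] [DecidableEq n]
    (M : Matrix n n ℂ) (hM : Mᴴ = -M) :
    ∃ (U : Matrix n n ℂ) (d : n → ℂ), Uᴴ * U = 1 ∧ U * Uᴴ = 1 ∧
      M = U * Matrix.diagonal d * Uᴴ ∧ ∀ i, (d i).re = 0 := by
  have hH : (Complex.I • M).IsHermitian := by
    simp [Matrix.IsHermitian, Matrix.conjTranspose_smul, hM]
  refine ⟨hH.eigenvectorUnitary, fun i => -Complex.I * (hH.eigenvalues i : ℂ),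
    Unitary.coe_star_mul_self _, Unitary.coe_mul_star_self _, ?_, fun i => by simp⟩
  have hspec := hH.spectral_theorem
  rw [Unitary.conjStarAlgAut_apply] at hspec
  have hsmul : M = (-Complex.I) • (Complex.I • M) := by simp [smul_smul]
  have hdiag : (Matrix.diagonal fun i => -Complex.I * (hH.eigenvalues i : ℂ)) =
      (-Complex.I) • Matrix.diagonal (RCLike.ofReal ∘ hH.eigenvalues : n → ℂ) := by
    rw [← Matrix.diagonal_smul]
    rfl
  rw [hdiag, Matrix.mul_smul, Matrix.smul_mul]
  exact hsmul.trans (congrArg ((-Complex.I) • ·) hspec)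

theorem roots_charpoly_unitary_conj_diagonal {n : Type*} [Fintype n] [DecidableEq n]
    (U : Matrix n n ℂ) (d : n → ℂ) (hU : Uᴴ * U = 1) :
    (U * Matrix.diagonal d * Uᴴ).charpoly.roots = Finset.univ.val.map d := by
  rw [Matrix.charpoly_mul_comm, ← Matrix.mul_assoc, hU, Matrix.one_mul,
    Matrix.charpoly_diagonal, Polynomial.roots_prod]
  · simp
  · simp [Finset.prod_ne_zero_iff, Polynomial.X_sub_C_ne_zero]

/-- If `W` is a contraction carrying one diagonal matrix to another by congruence, the
`ℓ¹` norm of the diagonal does not increase. -/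
theorem sum_norm_le_of_diagonal_eq_contraction_conj {n : Type*} [Fintype n] [DecidableEq n]
    (W : Matrix n n ℂ) (d e : n → ℂ) (hW : (1 - Wᴴ * W).PosSemidef)
    (h : Matrix.diagonal e = W * Matrix.diagonal d * Wᴴ) :
    ∑ i, ‖e i‖ ≤ ∑ i, ‖d i‖ := by
  have hcol (k : n) : ∑ j, ‖W j k‖ ^ 2 ≤ 1 := by
    have hk := hW.diag_nonneg (i := k)
    rw [Matrix.sub_apply, Matrix.one_apply_eq, sub_nonneg, Matrix.mul_apply] at hk
    have hsum : ∑ j, Wᴴ k j * W j k = ((∑ j, ‖W j k‖ ^ 2 : ℝ) : ℂ) := by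
      push_cast
      exact Finset.sum_congr rfl fun j _ => Complex.conj_mul' _
    rw [hsum] at hk
    exact_mod_cast hk
  have hentry (j : n) : ‖e j‖ ≤ ∑ k, ‖d k‖ * ‖W j k‖ ^ 2 := by
    have hj : e j = ∑ k, W j k * d k * star (W j k) := by
      have hjj := congrFun (congrFun h j) j
      rw [Matrix.mul_apply] at hjj
      simpa only [Matrix.diagonal_apply_eq, Matrix.mul_diagonal, Matrix.conjTranspose_apply]
        using hjj
    rw [hj]
    refine (norm_sum_le _ _).trans (Finset.sum_le_sum fun k _ => le_of_eq ?_)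
    rw [norm_mul, norm_mul, norm_star]
    ring
  calc ∑ j, ‖e j‖ ≤ ∑ j, ∑ k, ‖d k‖ * ‖W j k‖ ^ 2 := Finset.sum_le_sum fun j _ => hentry j
    _ = ∑ k, ‖d k‖ * ∑ j, ‖W j k‖ ^ 2 := by
      rw [Finset.sum_comm]
      simp only [Finset.mul_sum]
    _ ≤ ∑ k, ‖d k‖ := Finset.sum_le_sum fun k _ =>
      mul_le_of_le_one_right (norm_nonneg _) (hcol k)

/-- Congruence by a contraction does not increase the sum of the absolute values of the
imaginary parts of the eigenvalues of a skew-Hermitian matrix. -/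
theorem sum_abs_im_roots_charpoly_contraction_conj_le {n : Type*} [Fintype n] [DecidableEq n]
    (M K : Matrix n n ℂ) (hM : Mᴴ = -M) (hK : (1 - Kᴴ * K).PosSemidef) :
    ((K * M * Kᴴ).charpoly.roots.map fun z => |z.im|).sum ≤
      (M.charpoly.roots.map fun z => |z.im|).sum := by
  have hKM : (K * M * Kᴴ)ᴴ = -(K * M * Kᴴ) := by
    simp [Matrix.conjTranspose_mul, hM, Matrix.mul_assoc]
  obtain ⟨U, d, hU, hU', hMU, hd⟩ := exists_unitary_diagonal_of_skewHermitian M hM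
  obtain ⟨V, e, hV, hV', hKV, he⟩ := exists_unitary_diagonal_of_skewHermitian _ hKM
  have hnorm (z : ℂ) (hz : z.re = 0) : |z.im| = ‖z‖ := Complex.abs_im_eq_norm.2 hz
  have hW : (1 - (Vᴴ * K * U)ᴴ * (Vᴴ * K * U)).PosSemidef := by
    have hconj := hK.conjTranspose_mul_mul_same U
    have heq : (Vᴴ * K * U)ᴴ * (Vᴴ * K * U) = Uᴴ * Kᴴ * (V * Vᴴ) * K * U := by
      simp only [Matrix.conjTranspose_mul, Matrix.conjTranspose_conjTranspose, Matrix.mul_assoc]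
    rw [heq, hV', Matrix.mul_one]
    simpa only [Matrix.mul_sub, Matrix.sub_mul, Matrix.mul_one, hU, Matrix.mul_assoc] using hconj
  have hdiag : Matrix.diagonal e = (Vᴴ * K * U) * Matrix.diagonal d * (Vᴴ * K * U)ᴴ := by
    calc Matrix.diagonal e = (Vᴴ * V) * Matrix.diagonal e * (Vᴴ * V) := by simp [hV]
      _ = Vᴴ * (V * Matrix.diagonal e * Vᴴ) * V := by simp only [Matrix.mul_assoc]
      _ = Vᴴ * (K * (U * Matrix.diagonal d * Uᴴ) * Kᴴ) * V := by rw [← hKV, ← hMU]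
      _ = _ := by
        simp only [Matrix.conjTranspose_mul, Matrix.conjTranspose_conjTranspose, Matrix.mul_assoc]
  have hle := sum_norm_le_of_diagonal_eq_contraction_conj _ d e hW hdiag
  rw [hKV, roots_charpoly_unitary_conj_diagonal V e hV, hMU,
    roots_charpoly_unitary_conj_diagonal U d hU, Multiset.map_map, Multiset.map_map]
  change ∑ i, |(e i).im| ≤ ∑ i, |(d i).im|
  simpa only [hnorm _ (hd _), hnorm _ (he _)] using hle

theorem transpose_symplecticFormMat (N : ℕ) :
    (symplecticFormMat N)ᵀ = -symplecticFormMat N := by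
  ext i j
  simp only [symplecticFormMat, Matrix.transpose_apply, Matrix.of_apply, Matrix.neg_apply]
  split_ifs <;> first | omega | norm_num

theorem symplTrace_transpose_mul_self {N : ℕ} (S : Matrix (Fin (2*N)) (Fin (2*N)) ℝ) :
    symplTrace (Sᵀ * S) =
      (1/2) * ((((S * symplecticFormMat N * Sᵀ).map (algebraMap ℝ ℂ)).charpoly.roots.map
        fun z => |z.im|).sum) := by
  have hcp : ((symplecticFormMat N * (Sᵀ * S)).map (algebraMap ℝ ℂ)).charpoly =
      ((S * symplecticFormMat N * Sᵀ).map (algebraMap ℝ ℂ)).charpoly := by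
    rw [Matrix.charpoly_map, Matrix.charpoly_map, ← Matrix.mul_assoc, Matrix.charpoly_mul_comm,
      Matrix.mul_assoc]
  rw [← hcp]
  rfl

theorem exists_eq_transpose_mul_self_of_posSemidef {n : Type*} [Fintype n] [DecidableEq n]
    {A : Matrix n n ℝ} (hA : A.PosSemidef) : ∃ S : Matrix n n ℝ, A = Sᵀ * S :=
  CStarAlgebra.nonneg_iff_eq_star_mul_self.mp hA.nonneg

/-- Monotonicity of the symplectic trace under the Loewner order: if A, B are
positive definite with A ≥ B then str(A) ≥ str(B). -/
theorem symplTrace_monotone {N : ℕ} (A B : Matrix (Fin (2*N)) (Fin (2*N)) ℝ)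
    (hA : A.PosDef) (hB : B.PosDef) (hAB : (A - B).PosSemidef) :
    symplTrace B ≤ symplTrace A := by
  obtain ⟨S, rfl⟩ := exists_eq_transpose_mul_self_of_posSemidef hA.posSemidef
  obtain ⟨T, rfl⟩ := exists_eq_transpose_mul_self_of_posSemidef hB.posSemidef
  have hS : IsUnit S.det := by
    have hdet := hA.det_pos
    rw [Matrix.det_mul] at hdet
    exact (right_ne_zero_of_mul hdet.ne').isUnit
  obtain ⟨K, rfl⟩ : ∃ K, T = K * S := ⟨T * S⁻¹, (Matrix.nonsing_inv_mul_cancel_right S T hS).symm⟩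
  have hK : (1 - Kᵀ * K).PosSemidef := by
    have hunit : IsUnit S := (Matrix.isUnit_iff_isUnit_det S).2 hS
    rw [← Matrix.IsUnit.posSemidef_star_left_conjugate_iff hunit]
    convert hAB using 1
    simp [Matrix.star_eq_conjTranspose, Matrix.mul_sub, Matrix.sub_mul, Matrix.mul_assoc]
  have hKc : (1 - (K.map (algebraMap ℝ ℂ))ᴴ * K.map (algebraMap ℝ ℂ)).PosSemidef := by
    obtain ⟨R, hR⟩ := exists_eq_transpose_mul_self_of_posSemidef hK
    have hmap := congrArg (algebraMap ℝ ℂ).mapMatrix hR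
    rw [map_sub, map_one, map_mul, map_mul] at hmap
    simp only [RingHom.mapMatrix_apply] at hmap
    rw [conjTranspose_map_ofReal, hmap, ← conjTranspose_map_ofReal]
    exact Matrix.posSemidef_conjTranspose_mul_self _
  have hskew : ((S * symplecticFormMat N * Sᵀ).map (algebraMap ℝ ℂ))ᴴ =
      -(S * symplecticFormMat N * Sᵀ).map (algebraMap ℝ ℂ) := by
    have htr : (S * symplecticFormMat N * Sᵀ)ᵀ = -(S * symplecticFormMat N * Sᵀ) := by
      simp [Matrix.transpose_mul, transpose_symplecticFormMat, Matrix.mul_assoc]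
    rw [conjTranspose_map_ofReal, htr]
    exact map_neg (algebraMap ℝ ℂ).mapMatrix _
  have hconj : (K * S * symplecticFormMat N * (K * S)ᵀ).map (algebraMap ℝ ℂ) =
      K.map (algebraMap ℝ ℂ) * (S * symplecticFormMat N * Sᵀ).map (algebraMap ℝ ℂ) *
        (K.map (algebraMap ℝ ℂ))ᴴ := by
    rw [conjTranspose_map_ofReal, ← Matrix.map_mul, ← Matrix.map_mul, Matrix.transpose_mul]
    simp only [Matrix.mul_assoc]
  rw [symplTrace_transpose_mul_self, symplTrace_transpose_mul_self, hconj]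
  exact mul_le_mul_of_nonneg_left
    (sum_abs_im_roots_charpoly_contraction_conj_le _ _ hskew hKc) (by norm_num)
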